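/- Assume Δ > 0 and η ≤ Δ²/(36·λ₁*³). If X_t ∈ R for some t ≥ 0, then X_{t'} ∈ R for all t' ≥ t; that is, R is an absorbing region for the gradient descent iteration. -/

import Mathlib

open Matrix

/-- The largest singular value of a real matrix. -/
noncomputable def sigmaMax {m n : ℕ} (M : Matrix (Fin m) (Fin n) ℝ) : ℝ :=
  sSup {c : ℝ | ∃ v : EuclideanSpace ℝ (Fin n), ‖v‖ = 1 ∧
    c = ‖(EuclideanSpace.equiv (Fin m) ℝ).symm (M.mulVec ((EuclideanSpace.equiv (Fin n) ℝ) v))‖}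

/-- The smallest singular value (the `n`-th largest, for a matrix with `n` columns). -/
noncomputable def sigmaMin {m n : ℕ} (M : Matrix (Fin m) (Fin n) ℝ) : ℝ :=
  sInf {c : ℝ | ∃ v : EuclideanSpace ℝ (Fin n), ‖v‖ = 1 ∧
    c = ‖(EuclideanSpace.equiv (Fin m) ℝ).symm (M.mulVec ((EuclideanSpace.equiv (Fin n) ℝ) v))‖}

/-- Frobenius norm of a real matrix. -/
noncomputable def frobNorm {m n : ℕ} (M : Matrix (Fin m) (Fin n) ℝ) : ℝ :=
  Real.sqrt (∑ i, ∑ j, (M i j) ^ 2)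

/-- Gradient descent iterates `X_{t+1} = X_t + η (Σ - X_t X_tᵀ) X_t`. -/
noncomputable def gdIter {d r : ℕ} (S : Matrix (Fin d) (Fin d) ℝ) (η : ℝ)
    (X0 : Matrix (Fin d) (Fin r) ℝ) : ℕ → Matrix (Fin d) (Fin r) ℝ
  | 0 => X0
  | t + 1 => gdIter S η X0 t +
      η • ((S - gdIter S η X0 t * (gdIter S η X0 t)ᵀ) * gdIter S η X0 t)

/-- The top `r × r` block `U` (first `r` rows) of `X ∈ ℝ^{d×r}`. -/
def topBlock {d r : ℕ} (h : r ≤ d) (X : Matrix (Fin d) (Fin r) ℝ) :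
    Matrix (Fin r) (Fin r) ℝ :=
  fun i j => X (Fin.castLE h i) j

/-- The bottom `(d-r) × r` block `J` (last `d-r` rows) of `X ∈ ℝ^{d×r}`. -/
def botBlock {d r : ℕ} (X : Matrix (Fin d) (Fin r) ℝ) :
    Matrix (Fin (d - r)) (Fin r) ℝ :=
  fun i j => X ⟨r + (i : ℕ), by have := i.isLt; omega⟩ j

/-- The region `R = {X : σ₁(X)² ≤ 2λ₁*, σ₁(J)² ≤ λ_r* − Δ/2, σ_r(U)² ≥ Δ/4}`. -/
def inR {d r : ℕ} (h : r ≤ d) (lam1 lamr Δ : ℝ) (X : Matrix (Fin d) (Fin r) ℝ) : Prop :=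
  sigmaMax X ^ 2 ≤ 2 * lam1 ∧ sigmaMax (botBlock X) ^ 2 ≤ lamr - Δ / 2 ∧
    Δ / 4 ≤ sigmaMin (topBlock h X) ^ 2

/-- The region `R₂ = {X : σ₁(X)² ≤ 2λ₁*, σ₁(J)² ≤ λ_r* − Δ/2}`. -/
def inR2 {d r : ℕ} (lam1 lamr Δ : ℝ) (X : Matrix (Fin d) (Fin r) ℝ) : Prop :=
  sigmaMax X ^ 2 ≤ 2 * lam1 ∧ sigmaMax (botBlock X) ^ 2 ≤ lamr - Δ / 2


open scoped InnerProductSpace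

section Operators

variable {E F G : Type*}
  [NormedAddCommGroup E] [InnerProductSpace ℝ E]
  [NormedAddCommGroup F] [InnerProductSpace ℝ F]
  [NormedAddCommGroup G] [InnerProductSpace ℝ G]

/-- A linear map `Q` representing the Gram form of `J` satisfies `⟪Q v, v⟫ = ‖J v‖²`. -/
lemma gram_inner_self {J : E →ₗ[ℝ] G} {Q : E →ₗ[ℝ] E}
    (hQ : ∀ v w, ⟪Q v, w⟫_ℝ = ⟪J v, J w⟫_ℝ) (v : E) : ⟪Q v, v⟫_ℝ = ‖J v‖ ^ 2 := by
  rw [hQ, real_inner_self_eq_norm_sq]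

lemma gram_inner_gram {J : E →ₗ[ℝ] G} {Q : E →ₗ[ℝ] E}
    (hQ : ∀ v w, ⟪Q v, w⟫_ℝ = ⟪J v, J w⟫_ℝ) (v : E) :
    ⟪J v, J (Q v)⟫_ℝ = ‖Q v‖ ^ 2 := by
  rw [← hQ, real_inner_self_eq_norm_sq]

lemma norm_sub_smul_sq (x y : E) (η : ℝ) :
    ‖x - η • y‖ ^ 2 = ‖x‖ ^ 2 - 2 * η * ⟪x, y⟫_ℝ + η ^ 2 * ‖y‖ ^ 2 := by
  rw [norm_sub_sq_real, inner_smul_right, norm_smul, mul_pow, Real.norm_eq_abs, sq_abs]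
  ring

lemma norm_smul_sub_smul_sq (x y : E) (c η : ℝ) :
    ‖c • x - η • y‖ ^ 2 = c ^ 2 * ‖x‖ ^ 2 - 2 * c * η * ⟪x, y⟫_ℝ + η ^ 2 * ‖y‖ ^ 2 := by
  rw [norm_sub_smul_sq, inner_smul_left, norm_smul, mul_pow, Real.norm_eq_abs, sq_abs]
  simp only [conj_trivial]
  ring

lemma gram_norm_sq_le {J : E →ₗ[ℝ] G} {Q : E →ₗ[ℝ] E}
    (hQ : ∀ v w, ⟪Q v, w⟫_ℝ = ⟪J v, J w⟫_ℝ) {M : ℝ} (hM : 0 ≤ M)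
    (hJ : ∀ v, ‖J v‖ ^ 2 ≤ M * ‖v‖ ^ 2) (v : E) : ‖Q v‖ ^ 2 ≤ M * ‖J v‖ ^ 2 := by
  have h1 : ‖Q v‖ ^ 2 ≤ ‖J v‖ * ‖J (Q v)‖ := by
    rw [← gram_inner_gram hQ v]
    exact real_inner_le_norm _ _
  have h2 := hJ (Q v)
  have h3 : (‖Q v‖ ^ 2) ^ 2 ≤ (‖J v‖ * ‖J (Q v)‖) ^ 2 := by gcongr
  rcases (sq_nonneg ‖Q v‖).eq_or_lt with h | h
  · rw [← h]; positivity
  · have h4 : ‖J v‖ ^ 2 * ‖J (Q v)‖ ^ 2 ≤ ‖J v‖ ^ 2 * (M * ‖Q v‖ ^ 2) := by gcongr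
    refine le_of_mul_le_mul_right ?_ h
    nlinarith

lemma gram_norm_le {J : E →ₗ[ℝ] G} {Q : E →ₗ[ℝ] E}
    (hQ : ∀ v w, ⟪Q v, w⟫_ℝ = ⟪J v, J w⟫_ℝ) {M : ℝ} (hM : 0 ≤ M)
    (hJ : ∀ v, ‖J v‖ ^ 2 ≤ M * ‖v‖ ^ 2) (v : E) : ‖Q v‖ ≤ M * ‖v‖ := by
  refine le_of_sq_le_sq ?_ (by positivity)
  calc ‖Q v‖ ^ 2 ≤ M * ‖J v‖ ^ 2 := gram_norm_sq_le hQ hM hJ v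
    _ ≤ M * (M * ‖v‖ ^ 2) := by gcongr; exact hJ v
    _ = (M * ‖v‖) ^ 2 := by ring

/-- `1 - η Q` is a contraction when `0 ≤ Q ≤ M` and `η M ≤ 2`. -/
lemma norm_sub_smul_gram_le {J : E →ₗ[ℝ] G} {Q : E →ₗ[ℝ] E}
    (hQ : ∀ v w, ⟪Q v, w⟫_ℝ = ⟪J v, J w⟫_ℝ) {M η : ℝ} (hM : 0 ≤ M) (hη : 0 ≤ η)
    (hJ : ∀ v, ‖J v‖ ^ 2 ≤ M * ‖v‖ ^ 2) (hηM : η * M ≤ 2) (v : E) :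
    ‖v - η • Q v‖ ≤ ‖v‖ := by
  refine le_of_sq_le_sq ?_ (by positivity)
  rw [norm_sub_smul_sq, real_inner_comm, gram_inner_self hQ]
  have h := gram_norm_sq_le hQ hM hJ v
  have h1 : η ^ 2 * ‖Q v‖ ^ 2 ≤ η ^ 2 * (M * ‖J v‖ ^ 2) := by gcongr
  have h2 : (η * M) * (η * ‖J v‖ ^ 2) ≤ 2 * (η * ‖J v‖ ^ 2) := by gcongr
  nlinarith

/-- The map `σ ↦ σ (1 - η σ²)` is increasing on the singular values of `J`. -/
lemma norm_map_sub_smul_gram_le {J : E →ₗ[ℝ] G} {Q : E →ₗ[ℝ] E}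
    (hQ : ∀ v w, ⟪Q v, w⟫_ℝ = ⟪J v, J w⟫_ℝ) {s η : ℝ} (hs : 0 ≤ s) (hη : 0 ≤ η)
    (hJ : ∀ v, ‖J v‖ ^ 2 ≤ s ^ 2 * ‖v‖ ^ 2) (hηs : 4 * (η * s ^ 2) ≤ 1) (v : E) :
    ‖J v - η • J (Q v)‖ ≤ s * (1 - η * s ^ 2) * ‖v‖ := by
  have hpos : 0 ≤ η * s ^ 2 := by positivity
  have h0 : 0 ≤ 1 - η * s ^ 2 := by linarith
  refine le_of_sq_le_sq ?_ (by positivity)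
  rw [norm_sub_smul_sq, gram_inner_gram hQ]
  have h1 : 0 ≤ ‖Q v - s ^ 2 • v‖ ^ 2 := by positivity
  rw [norm_sub_smul_sq, gram_inner_self hQ] at h1
  have h2 : η ^ 2 * ‖J (Q v)‖ ^ 2 ≤ η ^ 2 * (s ^ 2 * ‖Q v‖ ^ 2) := by gcongr; exact hJ _
  have h3 := hJ v
  have hβ : 0 ≤ 2 * η - η ^ 2 * s ^ 2 := by nlinarith
  have hβ' : 0 ≤ 1 - 2 * (2 * η - η ^ 2 * s ^ 2) * s ^ 2 := by nlinarith
  have h4 := mul_nonneg hβ h1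
  have h5 := mul_nonneg hβ' (sub_nonneg.2 h3)
  nlinarith

/-- The gradient descent step keeps the norm of a block below `s`. -/
lemma norm_step_le {J : E →ₗ[ℝ] G} {P Q : E →ₗ[ℝ] E} {S : G →ₗ[ℝ] G}
    (hQ : ∀ v w, ⟪Q v, w⟫_ℝ = ⟪J v, J w⟫_ℝ) {s η b M : ℝ} (hs : 0 ≤ s) (hη : 0 ≤ η)
    (hb : 0 ≤ b) (hJ : ∀ v, ‖J v‖ ^ 2 ≤ s ^ 2 * ‖v‖ ^ 2) (hηs : 4 * (η * s ^ 2) ≤ 1)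
    (hP : ∀ v, ‖v - η • P v‖ ≤ ‖v‖) (hPM : ∀ v, ‖P v‖ ≤ M * ‖v‖)
    (hS : ∀ y, ‖S y‖ ≤ b * ‖y‖) (hbs : b + η * s ^ 2 * M ≤ s ^ 2) (v : E) :
    ‖J v + η • (S (J v) - J (P v + Q v))‖ ^ 2 ≤ s ^ 2 * ‖v‖ ^ 2 := by
  have hJ' : ∀ v, ‖J v‖ ≤ s * ‖v‖ := fun v ↦
    le_of_sq_le_sq (by rw [mul_pow]; exact hJ v) (by positivity)
  have hpos : 0 ≤ η * s ^ 2 := by positivity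
  have h0 : 0 ≤ 1 - η * s ^ 2 := by linarith
  have key : J v + η • (S (J v) - J (P v + Q v)) =
      (J (v - η • P v) - η • J (Q (v - η • P v))) + η • S (J v) - (η * η) • J (Q (P v)) := by
    simp only [map_sub, map_add, map_smul, smul_sub, smul_add, smul_smul]
    abel
  rw [← mul_pow, key]
  have h1 := norm_map_sub_smul_gram_le hQ hs hη hJ hηs (v - η • P v)
  have h1' : s * (1 - η * s ^ 2) * ‖v - η • P v‖ ≤ s * (1 - η * s ^ 2) * ‖v‖ := by
    gcongr; exact hP v
  have h2 : ‖η • S (J v)‖ ≤ η * (b * (s * ‖v‖)) := by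
    rw [norm_smul, Real.norm_of_nonneg hη]
    gcongr
    exact (hS _).trans (by gcongr; exact hJ' v)
  have h3 : ‖(η * η) • J (Q (P v))‖ ≤ (η * η) * (s * (s ^ 2 * (M * ‖v‖))) := by
    rw [norm_smul, Real.norm_of_nonneg (mul_nonneg hη hη)]
    gcongr
    refine (hJ' _).trans ?_
    gcongr
    refine (gram_norm_le hQ (sq_nonneg s) hJ _).trans ?_
    gcongr
    exact hPM v
  have h4 := norm_sub_le (J (v - η • P v) - η • J (Q (v - η • P v)) + η • S (J v))
    ((η * η) • J (Q (P v)))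
  have h5 := norm_add_le (J (v - η • P v) - η • J (Q (v - η • P v))) (η • S (J v))
  have h6 : 0 ≤ η * s * ‖v‖ * (s ^ 2 - (b + η * s ^ 2 * M)) :=
    mul_nonneg (by positivity) (sub_nonneg.2 hbs)
  gcongr
  nlinarith

/-- For a Gram operator `δ ≤ P ≤ M` one has `(M - P) (P - δ) ≥ 0`. -/
lemma gram_norm_sq_le_interpolate {U : E →ₗ[ℝ] F} {P : E →ₗ[ℝ] E}
    (hP : ∀ v w, ⟪P v, w⟫_ℝ = ⟪U v, U w⟫_ℝ) {δ M : ℝ} (hδM : δ < M)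
    (hlow : ∀ v, δ * ‖v‖ ^ 2 ≤ ‖U v‖ ^ 2) (hup : ∀ v, ‖U v‖ ^ 2 ≤ M * ‖v‖ ^ 2) (v : E) :
    ‖P v‖ ^ 2 + M * δ * ‖v‖ ^ 2 ≤ (M + δ) * ‖U v‖ ^ 2 := by
  have h1 := hlow (P v - M • v)
  have h2 := hup (P v - δ • v)
  rw [map_sub, map_smul, norm_sub_smul_sq, norm_sub_smul_sq, gram_inner_self hP,
    real_inner_comm, gram_inner_gram hP] at h1 h2
  have : 0 < M - δ := sub_pos.2 hδM
  refine le_of_mul_le_mul_left ?_ this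
  nlinarith

/-- The map `σ ↦ σ (c - η σ²)` is increasing on the singular values of `U`. -/
lemma le_norm_map_smul_sub_smul_gram {U : E →ₗ[ℝ] F} {P : E →ₗ[ℝ] E}
    (hP : ∀ v w, ⟪P v, w⟫_ℝ = ⟪U v, U w⟫_ℝ) {ρ M c η : ℝ} (hη : 0 ≤ η)
    (hδM : ρ ^ 2 < M) (hc : 1 ≤ c) (hηM : 4 * (η * M) ≤ 1)
    (hlow : ∀ v, ρ ^ 2 * ‖v‖ ^ 2 ≤ ‖U v‖ ^ 2) (hup : ∀ v, ‖U v‖ ^ 2 ≤ M * ‖v‖ ^ 2) (v : E) :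
    ρ * (c - η * ρ ^ 2) * ‖v‖ ≤ ‖U (c • v - η • P v)‖ := by
  refine le_of_sq_le_sq ?_ (by positivity)
  rw [map_sub, map_smul, map_smul, norm_smul_sub_smul_sq, gram_inner_gram hP]
  have h1 : η ^ 2 * (ρ ^ 2 * ‖P v‖ ^ 2) ≤ η ^ 2 * ‖U (P v)‖ ^ 2 := by gcongr; exact hlow _
  have h2 := gram_norm_sq_le_interpolate hP hδM hlow hup v
  have h3 := hlow v
  have hρη : η * ρ ^ 2 ≤ η * M := by gcongr
  have hρη' : 0 ≤ η * ρ ^ 2 := by positivity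
  have hβ : 0 ≤ 2 * c * η - η ^ 2 * ρ ^ 2 := by nlinarith
  have hβ' : 0 ≤ c ^ 2 - (2 * c * η - η ^ 2 * ρ ^ 2) * (M + ρ ^ 2) := by
    have e1 : 0 ≤ η ^ 2 * ρ ^ 2 * (M + ρ ^ 2) := by
      have : 0 ≤ M + ρ ^ 2 := by nlinarith
      positivity
    have e2 : 2 * c * (η * (M + ρ ^ 2)) ≤ 2 * c * (1 / 2) := by gcongr; linarith
    nlinarith
  have h4 := mul_nonneg hβ (sub_nonneg.2 h2)
  have h5 := mul_nonneg hβ' (sub_nonneg.2 h3)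
  nlinarith

/-- Lower bound for the part of the step on which the diagonal acts as a scalar. -/
lemma le_norm_scalar_step [FiniteDimensional ℝ E] {U : E →ₗ[ℝ] F} {P Q : E →ₗ[ℝ] E}
    (hP : ∀ v w, ⟪P v, w⟫_ℝ = ⟪U v, U w⟫_ℝ) {ρ M K c η a : ℝ} (hρ : 0 ≤ ρ) (hη : 0 ≤ η)
    (hδM : ρ ^ 2 < M) (hc : 1 ≤ c) (hηM : 4 * (η * M) ≤ 1)
    (hlow : ∀ v, ρ ^ 2 * ‖v‖ ^ 2 ≤ ‖U v‖ ^ 2) (hup : ∀ v, ‖U v‖ ^ 2 ≤ M * ‖v‖ ^ 2)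
    (hQ : ∀ v, ‖Q v‖ ≤ K * ‖v‖)
    (ha : a * (c - η * M) ≤ (c - η * ρ ^ 2) * (c - η * M - η * K)) (v : E) :
    ρ * a * ‖v‖ ≤ ‖U (c • v - η • (P v + Q v))‖ := by
  have hM : 0 ≤ M := (sq_nonneg ρ).trans hδM.le
  have hρη : η * ρ ^ 2 ≤ η * M := by gcongr
  have he : 0 < c - η * M := by linarith
  have hcoer : ∀ z, (c - η * M) * ‖z‖ ≤ ‖c • z - η • P z‖ := by
    intro z
    have h1 := norm_sub_norm_le (c • z) (η • P z)
    rw [norm_smul, norm_smul, Real.norm_of_nonneg hη,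
      Real.norm_of_nonneg (zero_le_one.trans hc)] at h1
    have h2 : η * ‖P z‖ ≤ η * (M * ‖z‖) := by gcongr; exact gram_norm_le hP hM hup z
    linarith
  have hinj : Function.Injective (c • LinearMap.id - η • P : E →ₗ[ℝ] E) := by
    rw [injective_iff_map_eq_zero]
    intro z hz
    have hz' : c • z - η • P z = 0 := by simpa using hz
    have h := hcoer z
    rw [hz', norm_zero] at h
    exact norm_le_zero_iff.1 (nonpos_of_mul_nonpos_right h he)
  obtain ⟨z, hz⟩ := LinearMap.injective_iff_surjective.1 hinj (η • Q v)
  have hz' : c • z - η • P z = η • Q v := by simpa using hz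
  have hzn : (c - η * M) * ‖z‖ ≤ η * (K * ‖v‖) := by
    refine (hcoer z).trans ?_
    rw [hz', norm_smul, Real.norm_of_nonneg hη]
    gcongr
    exact hQ v
  have key : c • v - η • (P v + Q v) = c • (v - z) - η • P (v - z) := by
    rw [smul_add, ← hz', map_sub]
    module
  rw [key]
  refine le_trans ?_ (le_norm_map_smul_sub_smul_gram hP hη hδM hc hηM hlow hup (v - z))
  rw [mul_assoc, mul_assoc]
  refine mul_le_mul_of_nonneg_left ?_ hρ
  have h1 := norm_sub_norm_le v z
  have h2 : 0 ≤ c - η * ρ ^ 2 := by linarith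
  refine le_of_mul_le_mul_left ?_ he
  calc (c - η * M) * (a * ‖v‖) = a * (c - η * M) * ‖v‖ := by ring
    _ ≤ (c - η * ρ ^ 2) * (c - η * M - η * K) * ‖v‖ := by gcongr
    _ = (c - η * ρ ^ 2) * ((c - η * M) * ‖v‖ - η * (K * ‖v‖)) := by ring
    _ ≤ (c - η * ρ ^ 2) * ((c - η * M) * ‖v‖ - (c - η * M) * ‖z‖) := by gcongr
    _ = (c - η * ρ ^ 2) * ((c - η * M) * (‖v‖ - ‖z‖)) := by ring
    _ ≤ (c - η * ρ ^ 2) * ((c - η * M) * ‖v - z‖) := by gcongr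
    _ = (c - η * M) * ((c - η * ρ ^ 2) * ‖v - z‖) := by ring

/-- Adding a positive semidefinite diagonal perturbation `D` of norm at most `L` costs at most
the second order term `η² L ‖w‖`. -/
lemma le_norm_add_perturbation {D : F →ₗ[ℝ] F} (hD : ∀ y, 0 ≤ ⟪D y, y⟫_ℝ) {L c η : ℝ}
    (hL : ∀ y, ‖D y‖ ≤ L * ‖y‖) (hc : 1 ≤ c) (hη : 0 ≤ η) (x w : F) :
    ‖c • x - η • w‖ - η ^ 2 * (L * ‖w‖) ≤ ‖c • x - η • w + η • D x‖ := by
  have hc0 : 0 < c := zero_lt_one.trans_le hc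
  set y := c • x - η • w with hy
  have hx : x = c⁻¹ • y + (c⁻¹ * η) • w := by
    rw [hy, smul_sub, smul_smul, smul_smul, inv_mul_cancel₀ hc0.ne']
    module
  have key : y + η • D x = (y + (η * c⁻¹) • D y) - (-(η ^ 2 * c⁻¹)) • D w := by
    conv_lhs => rw [hx]
    rw [map_add, map_smul, map_smul]
    module
  have h1 : ‖y‖ ≤ ‖y + (η * c⁻¹) • D y‖ := by
    refine le_of_sq_le_sq ?_ (by positivity)
    rw [norm_add_sq_real, inner_smul_right, real_inner_comm]
    have : 0 ≤ (η * c⁻¹) * ⟪D y, y⟫_ℝ := mul_nonneg (by positivity) (hD y)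
    have : 0 ≤ ‖(η * c⁻¹) • D y‖ ^ 2 := by positivity
    linarith
  have h2 := norm_sub_norm_le (y + (η * c⁻¹) • D y) ((-(η ^ 2 * c⁻¹)) • D w)
  have h3 : ‖(-(η ^ 2 * c⁻¹)) • D w‖ ≤ η ^ 2 * (L * ‖w‖) := by
    rw [norm_smul, norm_neg, Real.norm_of_nonneg (by positivity)]
    have hc1 : c⁻¹ ≤ 1 := inv_le_one_of_one_le₀ hc
    have : η ^ 2 * c⁻¹ ≤ η ^ 2 := mul_le_of_le_one_right (by positivity) hc1
    gcongr
    exact hL w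
  rw [key]
  linarith

end Operators

section Matrices

lemma toEuclideanLin_mul_apply {m n k : ℕ} (M : Matrix (Fin m) (Fin n) ℝ)
    (N : Matrix (Fin n) (Fin k) ℝ) (v : EuclideanSpace ℝ (Fin k)) :
    toEuclideanLin (M * N) v = toEuclideanLin M (toEuclideanLin N v) := by
  simp [Matrix.toLpLin_apply]

lemma inner_toEuclideanLin_gram {m n : ℕ} (M : Matrix (Fin m) (Fin n) ℝ)
    (v w : EuclideanSpace ℝ (Fin n)) :
    ⟪toEuclideanLin (Mᵀ * M) v, w⟫_ℝ = ⟪toEuclideanLin M v, toEuclideanLin M w⟫_ℝ := by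
  rw [toEuclideanLin_mul_apply, ← Matrix.conjTranspose_eq_transpose_of_trivial,
    Matrix.toEuclideanLin_conjTranspose_eq_adjoint, LinearMap.adjoint_inner_left]

lemma norm_toEuclideanLin_diagonal_le {n : ℕ} {a : Fin n → ℝ} {C : ℝ} (ha : ∀ i, 0 ≤ a i)
    (hC : 0 ≤ C) (haC : ∀ i, a i ≤ C) (y : EuclideanSpace ℝ (Fin n)) :
    ‖toEuclideanLin (diagonal a) y‖ ≤ C * ‖y‖ := by
  refine le_of_sq_le_sq ?_ (by positivity)
  rw [mul_pow, EuclideanSpace.norm_sq_eq, EuclideanSpace.norm_sq_eq, Finset.mul_sum]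
  refine Finset.sum_le_sum fun i _ ↦ ?_
  simp only [Matrix.toLpLin_apply, mulVec_diagonal, norm_mul, mul_pow]
  rw [Real.norm_of_nonneg (ha i)]
  gcongr
  · exact ha i
  · exact haC i

lemma inner_toEuclideanLin_diagonal_nonneg {n : ℕ} {a : Fin n → ℝ} (ha : ∀ i, 0 ≤ a i)
    (y : EuclideanSpace ℝ (Fin n)) : 0 ≤ ⟪toEuclideanLin (diagonal a) y, y⟫_ℝ := by
  rw [PiLp.inner_apply]
  refine Finset.sum_nonneg fun i _ ↦ ?_
  simp only [Matrix.toLpLin_apply, mulVec_diagonal, RCLike.inner_apply, conj_trivial]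
  nlinarith [mul_nonneg (ha i) (sq_nonneg (y i))]

lemma sigmaMax_sq_le_iff {m n : ℕ} {M : Matrix (Fin m) (Fin n) ℝ} {K : ℝ} (hK : 0 ≤ K) :
    sigmaMax M ^ 2 ≤ K ↔ ∀ v, ‖toEuclideanLin M v‖ ^ 2 ≤ K * ‖v‖ ^ 2 := by
  have hdef : sigmaMax M = sSup {c : ℝ | ∃ v : EuclideanSpace ℝ (Fin n), ‖v‖ = 1 ∧
    c = ‖toEuclideanLin M v‖} := rfl
  have h0 : 0 ≤ sigmaMax M := by
    rw [hdef]
    refine Real.sSup_nonneg ?_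
    rintro c ⟨v, -, rfl⟩
    positivity
  constructor
  · intro h v
    rcases eq_or_ne v 0 with rfl | hv
    · simp
    have hv' : 0 < ‖v‖ := norm_pos_iff.2 hv
    have hb : BddAbove {c : ℝ | ∃ v : EuclideanSpace ℝ (Fin n), ‖v‖ = 1 ∧
        c = ‖toEuclideanLin M v‖} := by
      refine ⟨‖(toEuclideanLin M).toContinuousLinearMap‖, ?_⟩
      rintro c ⟨w, hw, rfl⟩
      have := (toEuclideanLin M).toContinuousLinearMap.le_opNorm w
      rwa [hw, mul_one] at this
    have h1 : ‖toEuclideanLin M (‖v‖⁻¹ • v)‖ ≤ sigmaMax M := by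
      rw [hdef]
      refine le_csSup hb ⟨_, ?_, rfl⟩
      rw [norm_smul, norm_inv, norm_norm, inv_mul_cancel₀ hv'.ne']
    rw [map_smul, norm_smul, norm_inv, norm_norm, inv_mul_le_iff₀ hv'] at h1
    calc ‖toEuclideanLin M v‖ ^ 2 ≤ (‖v‖ * sigmaMax M) ^ 2 := by gcongr
      _ = sigmaMax M ^ 2 * ‖v‖ ^ 2 := by ring
      _ ≤ K * ‖v‖ ^ 2 := by gcongr
  · intro h
    rw [← Real.le_sqrt h0 hK, hdef]
    refine Real.sSup_le ?_ (Real.sqrt_nonneg _)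
    rintro c ⟨v, hv, rfl⟩
    refine Real.le_sqrt_of_sq_le ?_
    simpa [hv] using h v

lemma le_sigmaMin_sq_iff {m n : ℕ} (hn : 0 < n) {M : Matrix (Fin m) (Fin n) ℝ} {δ : ℝ} :
    δ ≤ sigmaMin M ^ 2 ↔ ∀ v, δ * ‖v‖ ^ 2 ≤ ‖toEuclideanLin M v‖ ^ 2 := by
  have hdef : sigmaMin M = sInf {c : ℝ | ∃ v : EuclideanSpace ℝ (Fin n), ‖v‖ = 1 ∧
    c = ‖toEuclideanLin M v‖} := rfl
  have hc : ∀ c ∈ {c : ℝ | ∃ v : EuclideanSpace ℝ (Fin n), ‖v‖ = 1 ∧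
    c = ‖toEuclideanLin M v‖}, 0 ≤ c := by
    rintro c ⟨v, -, rfl⟩
    positivity
  have h0 : 0 ≤ sigmaMin M := by
    rw [hdef]
    exact Real.sInf_nonneg hc
  constructor
  · intro h v
    rcases eq_or_ne v 0 with rfl | hv
    · simp
    have hv' : 0 < ‖v‖ := norm_pos_iff.2 hv
    have h1 : sigmaMin M ≤ ‖toEuclideanLin M (‖v‖⁻¹ • v)‖ := by
      rw [hdef]
      refine csInf_le ⟨0, hc⟩ ⟨_, ?_, rfl⟩
      rw [norm_smul, norm_inv, norm_norm, inv_mul_cancel₀ hv'.ne']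
    rw [map_smul, norm_smul, norm_inv, norm_norm, le_inv_mul_iff₀ hv'] at h1
    calc δ * ‖v‖ ^ 2 ≤ sigmaMin M ^ 2 * ‖v‖ ^ 2 := by gcongr
      _ = (‖v‖ * sigmaMin M) ^ 2 := by ring
      _ ≤ ‖toEuclideanLin M v‖ ^ 2 := by gcongr
  · intro h
    rw [← Real.sqrt_le_left h0, hdef]
    refine le_csInf ⟨_, EuclideanSpace.single ⟨0, hn⟩ 1, by simp, rfl⟩ ?_
    rintro c ⟨v, hv, rfl⟩
    rw [Real.sqrt_le_left (norm_nonneg _)]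
    simpa [hv] using h v

lemma sum_castLE_add_sum {d r : ℕ} (h : r ≤ d) (f : Fin d → ℝ) :
    ∑ i, f i = ∑ i : Fin r, f (Fin.castLE h i) +
      ∑ i : Fin (d - r), f ⟨r + (i : ℕ), by have := i.isLt; omega⟩ := by
  rw [← Equiv.sum_comp (finCongr (Nat.add_sub_cancel' h)) f, Fin.sum_univ_add]
  rfl

lemma gram_eq_add {d r : ℕ} (h : r ≤ d) (X : Matrix (Fin d) (Fin r) ℝ) :
    Xᵀ * X = (topBlock h X)ᵀ * topBlock h X + (botBlock X)ᵀ * botBlock X := by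
  ext i j
  simp only [Matrix.add_apply, Matrix.mul_apply, Matrix.transpose_apply]
  exact sum_castLE_add_sum h _

lemma norm_sq_eq_topBlock_add_botBlock {d r : ℕ} (h : r ≤ d) (X : Matrix (Fin d) (Fin r) ℝ)
    (v : EuclideanSpace ℝ (Fin r)) :
    ‖toEuclideanLin X v‖ ^ 2 =
      ‖toEuclideanLin (topBlock h X) v‖ ^ 2 + ‖toEuclideanLin (botBlock X) v‖ ^ 2 := by
  simp only [← real_inner_self_eq_norm_sq, ← inner_toEuclideanLin_gram]
  rw [gram_eq_add h X, map_add, LinearMap.add_apply, inner_add_left]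

lemma gd_step_eq {d r : ℕ} (S : Matrix (Fin d) (Fin d) ℝ) (η : ℝ)
    (X : Matrix (Fin d) (Fin r) ℝ) :
    X + η • ((S - X * Xᵀ) * X) = X + η • (S * X - X * (Xᵀ * X)) := by
  rw [Matrix.sub_mul, Matrix.mul_assoc]

lemma topBlock_gd_step {d r : ℕ} (h : r ≤ d) (lam : Fin d → ℝ) (η : ℝ)
    (X : Matrix (Fin d) (Fin r) ℝ) :
    topBlock h (X + η • ((diagonal lam - X * Xᵀ) * X)) =
      topBlock h X + η • (diagonal (fun i ↦ lam (Fin.castLE h i)) * topBlock h X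
        - topBlock h X * (Xᵀ * X)) := by
  rw [gd_step_eq]
  ext i j
  simp [topBlock, Matrix.mul_apply, diagonal_apply]

lemma botBlock_gd_step {d r : ℕ} (lam : Fin d → ℝ) (η : ℝ) (X : Matrix (Fin d) (Fin r) ℝ) :
    botBlock (X + η • ((diagonal lam - X * Xᵀ) * X)) =
      botBlock X + η • (diagonal
          (fun i : Fin (d - r) ↦ lam ⟨r + (i : ℕ), by have := i.isLt; omega⟩) * botBlock X
        - botBlock X * (Xᵀ * X)) := by
  rw [gd_step_eq]
  ext i j
  simp [botBlock, Matrix.mul_apply, diagonal_apply]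

lemma toEuclideanLin_step_apply {m n : ℕ} (Y : Matrix (Fin m) (Fin n) ℝ)
    (S : Matrix (Fin m) (Fin m) ℝ) (A : Matrix (Fin n) (Fin n) ℝ) (η : ℝ)
    (v : EuclideanSpace ℝ (Fin n)) :
    toEuclideanLin (Y + η • (S * Y - Y * A)) v = toEuclideanLin Y v +
      η • (toEuclideanLin S (toEuclideanLin Y v) - toEuclideanLin Y (toEuclideanLin A v)) := by
  simp only [map_add, map_smul, map_sub, LinearMap.add_apply, LinearMap.smul_apply,
    LinearMap.sub_apply, toEuclideanLin_mul_apply]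

end Matrices

/-- One gradient descent step maps the region into itself. -/
lemma inR_gd_step {d r : ℕ} (hr : 0 < r) (hrd : r < d) {lam : Fin d → ℝ} {L x Δ η : ℝ}
    (hnn : ∀ i, 0 ≤ lam i) (hL : ∀ i, lam i ≤ L)
    (htop : ∀ i : Fin r, x ≤ lam (Fin.castLE hrd.le i))
    (hbot : ∀ i : Fin (d - r), lam ⟨r + (i : ℕ), by have := i.isLt; omega⟩ ≤ x - Δ)
    (hΔ : 0 < Δ) (hΔx : Δ ≤ x) (hxL : x ≤ L) (hη : 0 < η) (hηle : 36 * (η * L ^ 3) ≤ Δ ^ 2)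
    {X : Matrix (Fin d) (Fin r) ℝ} (hX : inR hrd.le L x Δ X) :
    inR hrd.le L x Δ (X + η • ((diagonal lam - X * Xᵀ) * X)) := by
  have hLpos : 0 < L := by linarith
  have hηL2 : 36 * (η * L ^ 2) ≤ Δ := by
    refine le_of_mul_le_mul_right ?_ hLpos
    nlinarith
  have hηL : 36 * (η * L) ≤ 1 := by
    refine le_of_mul_le_mul_right ?_ hLpos
    nlinarith
  have hK : 0 ≤ x - Δ / 2 := by linarith
  obtain ⟨hX1, hX2, hX3⟩ := hX
  rw [sigmaMax_sq_le_iff (by positivity)] at hX1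
  rw [sigmaMax_sq_le_iff hK] at hX2
  rw [le_sigmaMin_sq_iff hr] at hX3
  set U := topBlock hrd.le X with hU
  set J := botBlock X with hJ
  have hgram : ∀ v, toEuclideanLin (Xᵀ * X) v =
      toEuclideanLin (Uᵀ * U) v + toEuclideanLin (Jᵀ * J) v := by
    intro v
    rw [gram_eq_add hrd.le X, map_add, LinearMap.add_apply]
  have hUup : ∀ v, ‖toEuclideanLin U v‖ ^ 2 ≤ 2 * L * ‖v‖ ^ 2 := by
    intro v
    have h1 := hX1 v
    have h2 := norm_sq_eq_topBlock_add_botBlock hrd.le X v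
    nlinarith [sq_nonneg ‖toEuclideanLin J v‖]
  have hs1 : √(2 * L) ^ 2 = 2 * L := Real.sq_sqrt (by positivity)
  have hs2 : √(x - Δ / 2) ^ 2 = x - Δ / 2 := Real.sq_sqrt hK
  have hηx : η * x ≤ η * L := by gcongr
  refine ⟨?_, ?_, ?_⟩
  · rw [sigmaMax_sq_le_iff (by positivity), gd_step_eq]
    intro v
    rw [toEuclideanLin_step_apply]
    have h := norm_step_le (J := toEuclideanLin X) (P := 0) (S := toEuclideanLin (diagonal lam))
      (b := L) (M := 0) (inner_toEuclideanLin_gram X) (Real.sqrt_nonneg (2 * L)) hη.le hLpos.le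
      (by rwa [hs1]) (by rw [hs1]; linarith) (by simp) (by simp)
      (norm_toEuclideanLin_diagonal_le hnn hLpos.le hL) (by rw [hs1]; linarith) v
    rwa [hs1, LinearMap.zero_apply, zero_add] at h
  · rw [sigmaMax_sq_le_iff hK, botBlock_gd_step]
    intro v
    rw [toEuclideanLin_step_apply, hgram]
    have h := norm_step_le (J := toEuclideanLin J) (P := toEuclideanLin (Uᵀ * U))
      (S := toEuclideanLin (diagonal
          (fun i : Fin (d - r) ↦ lam ⟨r + (i : ℕ), by have := i.isLt; omega⟩)))
      (b := x - Δ) (M := 2 * L) (inner_toEuclideanLin_gram J)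
      (Real.sqrt_nonneg (x - Δ / 2)) hη.le (by linarith)
      (by rwa [hs2]) (by rw [hs2]; nlinarith)
      (norm_sub_smul_gram_le (inner_toEuclideanLin_gram U) (by positivity) hη.le hUup
        (by linarith))
      (gram_norm_le (inner_toEuclideanLin_gram U) (by positivity) hUup)
      (norm_toEuclideanLin_diagonal_le (fun i ↦ hnn _) (by linarith) hbot)
      (by
        rw [hs2]
        have : η * (x - Δ / 2) * (2 * L) ≤ η * L * (2 * L) := by gcongr; linarith
        nlinarith) v
    rwa [hs2] at h
  · rw [le_sigmaMin_sq_iff hr, topBlock_gd_step]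
    intro v
    rw [toEuclideanLin_step_apply]
    set ρ := √(Δ / 4) with hρdef
    have hρ : 0 ≤ ρ := Real.sqrt_nonneg _
    have hρ2 : ρ ^ 2 = Δ / 4 := Real.sq_sqrt (by positivity)
    have hc : 1 ≤ 1 + η * x := by
      have : 0 ≤ η * x := mul_nonneg hη.le (by linarith)
      linarith
    have hscalar := le_norm_scalar_step (a := 1 + η * (Δ / 6)) (M := 2 * L)
      (inner_toEuclideanLin_gram U) hρ hη.le (by rw [hρ2]; linarith) hc (by linarith)
      (by rwa [hρ2]) hUup (gram_norm_le (inner_toEuclideanLin_gram J) hK hX2)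
      (by
        rw [hρ2]
        have h1 : η * (x * L) ≤ η * (L * L) := by gcongr
        have h2 : 0 ≤ η * (Δ * L) := by positivity
        have h3 : 0 ≤ η * (Δ * (x - Δ)) :=
          mul_nonneg hη.le (mul_nonneg hΔ.le (by linarith))
        have h4 : 0 ≤ η * (Δ * Δ) := by positivity
        have h5 : 0 ≤ η * (Δ * (L - x)) :=
          mul_nonneg hη.le (mul_nonneg hΔ.le (by linarith))
        have key : 0 ≤ η * ((Δ / 4 - Δ / 6) + η * ((x - Δ / 4) * (Δ / 2 - 2 * L)
            - Δ / 6 * (x - 2 * L))) := mul_nonneg hη.le (by nlinarith)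
        linear_combination key) v
    have hD0 : ∀ i : Fin r, 0 ≤ lam (Fin.castLE hrd.le i) - x := fun i ↦
      sub_nonneg.2 (htop i)
    have hpert := le_norm_add_perturbation (L := L)
      (inner_toEuclideanLin_diagonal_nonneg hD0)
      (norm_toEuclideanLin_diagonal_le hD0 hLpos.le
        (fun i ↦ by have := hL (Fin.castLE hrd.le i); linarith)) hc hη.le
      (toEuclideanLin U v) (toEuclideanLin U (toEuclideanLin (Xᵀ * X) v))
    have hdiag : (diagonal fun i ↦ lam (Fin.castLE hrd.le i)) =
        x • (1 : Matrix (Fin r) (Fin r) ℝ) +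
          diagonal (fun i ↦ lam (Fin.castLE hrd.le i) - x) := by
      rw [smul_one_eq_diagonal, diagonal_add]
      simp
    have hstep : toEuclideanLin U v +
        η • (toEuclideanLin (diagonal fun i ↦ lam (Fin.castLE hrd.le i)) (toEuclideanLin U v)
          - toEuclideanLin U (toEuclideanLin (Xᵀ * X) v)) =
        (1 + η * x) • toEuclideanLin U v - η • toEuclideanLin U (toEuclideanLin (Xᵀ * X) v) +
          η • toEuclideanLin (diagonal fun i ↦ lam (Fin.castLE hrd.le i) - x)
            (toEuclideanLin U v) := by
      rw [hdiag, map_add, LinearMap.add_apply, map_smul, LinearMap.smul_apply,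
        Matrix.toLpLin_one, LinearMap.id_apply]
      module
    rw [← hgram, map_sub, map_smul, map_smul] at hscalar
    have hw : ‖toEuclideanLin U (toEuclideanLin (Xᵀ * X) v)‖ ≤
        √(2 * L) * (2 * L * ‖v‖) := by
      have h1 : ∀ z, ‖toEuclideanLin U z‖ ≤ √(2 * L) * ‖z‖ := fun z ↦
        le_of_sq_le_sq (by rw [mul_pow, hs1]; exact hUup z) (by positivity)
      refine (h1 _).trans ?_
      gcongr
      exact gram_norm_le (inner_toEuclideanLin_gram X) (by positivity) hX1 v
    have hsmall : η * (L * (√(2 * L) * (2 * L))) ≤ ρ * (Δ / 6) := by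
      refine le_of_sq_le_sq ?_ (by positivity)
      have e1 : (η * (L * (√(2 * L) * (2 * L)))) ^ 2 = 8 * (η * L ^ 3) * (η * L ^ 2) := by
        calc _ = η ^ 2 * L ^ 2 * √(2 * L) ^ 2 * (2 * L) ^ 2 := by ring
          _ = _ := by rw [hs1]; ring
      have e2 : (ρ * (Δ / 6)) ^ 2 = Δ ^ 2 * Δ / 144 := by
        rw [mul_pow, hρ2]; ring
      rw [e1, e2]
      have e3 : (36 * (η * L ^ 3)) * (36 * (η * L ^ 2)) ≤ Δ ^ 2 * Δ := by gcongr
      have e4 : 0 ≤ Δ ^ 2 * Δ := by positivity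
      linarith
    rw [hstep, ← hρ2, ← mul_pow]
    gcongr
    refine le_trans ?_ hpert
    have h1 : η ^ 2 * (L * ‖toEuclideanLin U (toEuclideanLin (Xᵀ * X) v)‖) ≤
        η ^ 2 * (L * (√(2 * L) * (2 * L * ‖v‖))) := by gcongr
    have h2 : η * ‖v‖ * (η * (L * (√(2 * L) * (2 * L)))) ≤ η * ‖v‖ * (ρ * (Δ / 6)) := by
      gcongr
    linarith

/-- Lemma 2.2: `R` is an absorbing region for gradient descent. -/
theorem R_absorbing (d r : ℕ) (hr : 0 < r) (hrd : r < d)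
    (lam : Fin d → ℝ)
    (hmono : ∀ i j : Fin d, i ≤ j → lam j ≤ lam i)
    (hnn : ∀ i, 0 ≤ lam i)
    (η : ℝ) (hη : 0 < η)
    (hΔ : 0 < lam ⟨r - 1, by omega⟩ - lam ⟨r, hrd⟩)
    (hηle : η ≤ (lam ⟨r - 1, by omega⟩ - lam ⟨r, hrd⟩) ^ 2 / (36 * lam ⟨0, by omega⟩ ^ 3))
    (X0 : Matrix (Fin d) (Fin r) ℝ) (t : ℕ)
    (ht : inR hrd.le (lam ⟨0, by omega⟩) (lam ⟨r - 1, by omega⟩)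
      (lam ⟨r - 1, by omega⟩ - lam ⟨r, hrd⟩) (gdIter (Matrix.diagonal lam) η X0 t)) :
    ∀ t' : ℕ, t ≤ t' →
      inR hrd.le (lam ⟨0, by omega⟩) (lam ⟨r - 1, by omega⟩)
        (lam ⟨r - 1, by omega⟩ - lam ⟨r, hrd⟩) (gdIter (Matrix.diagonal lam) η X0 t') := by
  have hη36 : 36 * (η * lam ⟨0, by omega⟩ ^ 3) ≤
      (lam ⟨r - 1, by omega⟩ - lam ⟨r, hrd⟩) ^ 2 := by
    have hpos : 0 < lam ⟨0, by omega⟩ := by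
      have h1 := hmono ⟨0, by omega⟩ ⟨r - 1, by omega⟩ (by simp [Fin.le_def])
      have h2 := hnn ⟨r, hrd⟩
      linarith
    rw [le_div_iff₀ (by positivity)] at hηle
    linarith
  intro t' htt'
  induction t', htt' using Nat.le_induction with
  | base => exact ht
  | succ k _ ih =>
    refine inR_gd_step hr hrd hnn (fun i ↦ hmono _ _ (by simp [Fin.le_def])) (fun i ↦ ?_)
      (fun i ↦ ?_) hΔ ?_ (hmono _ _ (by simp [Fin.le_def])) hη hη36 ih
    · refine hmono _ _ ?_
      have := i.isLt
      simp only [Fin.le_def, Fin.val_castLE]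
      omega
    · rw [sub_sub_cancel]
      exact hmono _ _ (by simp [Fin.le_def])
    · linarith [hnn ⟨r, hrd⟩]
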